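/- Shearer's inequality: let X = (X₁, …, X_k) be a random vector of finitely-valued random variables on a discrete probability space, and let nonnegative reals α_A be given for every subset A ⊆ {1,…,k} such that for every i ∈ {1,…,k}, the sum of α_A over all A containing i is at least 1. Then H(X) ≤ Σ_{A ⊆ {1,…,k}} α_A · H(X_A), where X_A = (X_i : i ∈ A) and H denotes Shannon entropy. -/

import Mathlib

open Finset

/-- The probability that the random variable `X` (on a finite discrete probability
space with mass function `p`) takes the value `x`. -/
noncomputable def probOf {Ω α : Type*} [Fintype Ω] [DecidableEq α]
    (p : Ω → ℝ) (X : Ω → α) (x : α) : ℝ :=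
  ∑ ω ∈ Finset.univ.filter (fun ω => X ω = x), p ω

/-- The Shannon entropy (base 2) of a finitely-valued random variable `X` on a finite
discrete probability space with mass function `p`; the convention `0·log(1/0) = 0`
holds since `Real.logb 2 0 = 0`. -/
noncomputable def shannonEntropy {Ω α : Type*} [Fintype Ω] [Fintype α] [DecidableEq α]
    (p : Ω → ℝ) (X : Ω → α) : ℝ :=
  ∑ x : α, -(probOf p X x * Real.logb 2 (probOf p X x))

section Entropy

variable {Ω : Type*} [Fintype Ω] {p : Ω → ℝ}

lemma probOf_nonneg {β : Type*} [DecidableEq β] (hp : ∀ ω, 0 ≤ p ω) (X : Ω → β) (x : β) :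
    0 ≤ probOf p X x :=
  Finset.sum_nonneg fun ω _ => hp ω

lemma probOf_self_pos {β : Type*} [DecidableEq β] (hp : ∀ ω, 0 ≤ p ω) (X : Ω → β) {ω : Ω}
    (hω : 0 < p ω) : 0 < probOf p X (X ω) :=
  hω.trans_le (Finset.single_le_sum (f := p) (fun ω _ => hp ω) (by simp))

lemma probOf_self_le_of_imp {β γ : Type*} [DecidableEq β] [DecidableEq γ] (hp : ∀ ω, 0 ≤ p ω)
    {X : Ω → β} {Y : Ω → γ} (h : ∀ ω ω', Y ω' = Y ω → X ω' = X ω) (ω : Ω) :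
    probOf p Y (Y ω) ≤ probOf p X (X ω) :=
  Finset.sum_le_sum_of_subset_of_nonneg
    (Finset.monotone_filter_right _ fun ω' _ => h ω ω') fun ω _ _ => hp ω

/-- Expectation of a function of `X`, computed on the range of `X`. -/
lemma sum_probOf_mul {β : Type*} [Fintype β] [DecidableEq β] (X : Ω → β) (f : β → ℝ) :
    ∑ x, probOf p X x * f x = ∑ ω, p ω * f (X ω) := by
  rw [← Finset.sum_fiberwise_of_maps_to (s := Finset.univ) (t := Finset.univ) (g := X) (by simp)]
  refine Finset.sum_congr rfl fun x _ => ?_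
  rw [probOf, Finset.sum_mul]
  exact Finset.sum_congr rfl fun ω hω => by rw [(Finset.mem_filter.1 hω).2]

lemma sum_probOf_prodMk_left {β γ : Type*} [Fintype β] [DecidableEq β] [DecidableEq γ]
    (U : Ω → β) (W : Ω → γ) (c : γ) :
    ∑ u, probOf p (fun ω => (U ω, W ω)) (u, c) = probOf p W c := by
  unfold probOf
  rw [← Finset.sum_fiberwise_of_maps_to (s := Finset.univ.filter fun ω => W ω = c)
    (t := Finset.univ) (g := U) (by simp)]
  refine Finset.sum_congr rfl fun u _ => Finset.sum_congr ?_ fun _ _ => rfl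
  ext ω
  simp [and_comm]

lemma shannonEntropy_eq_sum {β : Type*} [Fintype β] [DecidableEq β] (X : Ω → β) :
    shannonEntropy p X = (∑ ω, p ω * -Real.log (probOf p X (X ω))) / Real.log 2 := by
  rw [← sum_probOf_mul X fun x => -Real.log (probOf p X x), Finset.sum_div]
  exact Finset.sum_congr rfl fun x _ => by rw [Real.logb]; ring

/-- Entropy is monotone: if `X` is determined by `Y`, then `H(X) ≤ H(Y)`. -/
lemma shannonEntropy_le_of_imp {β γ : Type*} [Fintype β] [DecidableEq β] [Fintype γ]
    [DecidableEq γ] (hp : ∀ ω, 0 ≤ p ω) {X : Ω → β} {Y : Ω → γ}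
    (h : ∀ ω ω', Y ω' = Y ω → X ω' = X ω) : shannonEntropy p X ≤ shannonEntropy p Y := by
  rw [shannonEntropy_eq_sum, shannonEntropy_eq_sum]
  refine div_le_div_of_nonneg_right (Finset.sum_le_sum fun ω _ => ?_)
    (Real.log_nonneg one_le_two)
  rcases (hp ω).eq_or_lt with h0 | h0
  · simp [← h0]
  · exact mul_le_mul_of_nonneg_left (neg_le_neg (Real.log_le_log (probOf_self_pos hp Y h0)
      (probOf_self_le_of_imp hp h ω))) (hp ω)

lemma shannonEntropy_congr {β γ : Type*} [Fintype β] [DecidableEq β] [Fintype γ]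
    [DecidableEq γ] (hp : ∀ ω, 0 ≤ p ω) {X : Ω → β} {Y : Ω → γ}
    (h : ∀ ω ω', X ω' = X ω ↔ Y ω' = Y ω) : shannonEntropy p X = shannonEntropy p Y :=
  (shannonEntropy_le_of_imp hp fun ω ω' => (h ω ω').2).antisymm
    (shannonEntropy_le_of_imp hp fun ω ω' => (h ω ω').1)

lemma shannonEntropy_of_subsingleton {β : Type*} [Fintype β] [DecidableEq β] [Subsingleton β]
    (hp1 : ∑ ω, p ω = 1) (X : Ω → β) : shannonEntropy p X = 0 := by
  have h (ω : Ω) : probOf p X (X ω) = 1 := by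
    simp [probOf, Subsingleton.elim (X _) (X ω), hp1]
  simp [shannonEntropy_eq_sum, h]

/-- The total mass of the conditionally independent coupling of `(U, W)` and `(V, W)`,
restricted to the support of `(U, V, W)`, is at most one. -/
lemma sum_mul_probOf_ratio_le_one {β γ δ : Type*} [Fintype β] [DecidableEq β] [Fintype γ]
    [DecidableEq γ] [Fintype δ] [DecidableEq δ] (hp : ∀ ω, 0 ≤ p ω) (hp1 : ∑ ω, p ω = 1)
    (U : Ω → β) (V : Ω → γ) (W : Ω → δ) :
    ∑ ω, p ω * (probOf p (fun ω => (U ω, W ω)) (U ω, W ω) *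
      probOf p (fun ω => (V ω, W ω)) (V ω, W ω) /
      (probOf p (fun ω => (U ω, V ω, W ω)) (U ω, V ω, W ω) * probOf p W (W ω))) ≤ 1 := by
  rw [← sum_probOf_mul (fun ω => (U ω, V ω, W ω)) fun x : β × γ × δ =>
    probOf p (fun ω => (U ω, W ω)) (x.1, x.2.2) * probOf p (fun ω => (V ω, W ω)) x.2 /
      (probOf p (fun ω => (U ω, V ω, W ω)) x * probOf p W x.2.2)]
  calc
    _ ≤ ∑ x : β × γ × δ, probOf p (fun ω => (U ω, W ω)) (x.1, x.2.2) *
          probOf p (fun ω => (V ω, W ω)) x.2 / probOf p W x.2.2 := by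
      refine Finset.sum_le_sum fun x _ => ?_
      have hW := probOf_nonneg hp W x.2.2
      have hUW := probOf_nonneg hp (fun ω => (U ω, W ω)) (x.1, x.2.2)
      have hVW := probOf_nonneg hp (fun ω => (V ω, W ω)) x.2
      rcases eq_or_ne (probOf p (fun ω => (U ω, V ω, W ω)) x) 0 with h | h
      · rw [h, zero_mul]
        positivity
      · rw [← mul_div_assoc, mul_div_mul_left _ _ h]
    _ = ∑ c, probOf p W c * probOf p W c / probOf p W c := by
      simp only [Fintype.sum_prod_type]
      rw [Finset.sum_comm' (t' := Finset.univ) (s' := fun _ => Finset.univ) (by simp)]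
      rw [Finset.sum_congr rfl fun v _ => Finset.sum_comm, Finset.sum_comm]
      refine Finset.sum_congr rfl fun c _ => ?_
      simp only [← Finset.sum_div, ← Finset.sum_mul, ← Finset.mul_sum, sum_probOf_prodMk_left]
    _ = ∑ c, probOf p W c * 1 := by simp [mul_self_div_self]
    _ ≤ 1 := by rw [sum_probOf_mul W fun _ => 1]; simp [hp1]

/-- Submodularity of entropy: `H(U, V, W) + H(W) ≤ H(U, W) + H(V, W)`. -/
lemma shannonEntropy_submodular {β γ δ : Type*} [Fintype β] [DecidableEq β] [Fintype γ]
    [DecidableEq γ] [Fintype δ] [DecidableEq δ] (hp : ∀ ω, 0 ≤ p ω) (hp1 : ∑ ω, p ω = 1)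
    (U : Ω → β) (V : Ω → γ) (W : Ω → δ) :
    shannonEntropy p (fun ω => (U ω, V ω, W ω)) + shannonEntropy p W ≤
      shannonEntropy p (fun ω => (U ω, W ω)) + shannonEntropy p (fun ω => (V ω, W ω)) := by
  simp only [shannonEntropy_eq_sum, ← add_div, ← Finset.sum_add_distrib]
  refine div_le_div_of_nonneg_right ?_ (Real.log_nonneg one_le_two)
  rw [← sub_nonpos, ← Finset.sum_sub_distrib]
  refine (Finset.sum_le_sum fun ω _ => ?_).trans ((Finset.sum_sub_distrib _ _).trans_le
    (sub_nonpos.2 ((sum_mul_probOf_ratio_le_one hp hp1 U V W).trans hp1.ge)))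
  rcases (hp ω).eq_or_lt with h0 | h0
  · simp [← h0]
  · have hUVW := probOf_self_pos hp (fun ω => (U ω, V ω, W ω)) h0
    have hUW := probOf_self_pos hp (fun ω => (U ω, W ω)) h0
    have hVW := probOf_self_pos hp (fun ω => (V ω, W ω)) h0
    have hW := probOf_self_pos hp W h0
    have key := mul_le_mul_of_nonneg_left (Real.log_le_sub_one_of_pos
      (div_pos (mul_pos hUW hVW) (mul_pos hUVW hW))) (hp ω)
    rw [Real.log_div (mul_pos hUW hVW).ne' (mul_pos hUVW hW).ne', Real.log_mul hUW.ne' hVW.ne',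
      Real.log_mul hUVW.ne' hW.ne'] at key
    linarith

end Entropy

/-- Shearer's inequality for monotone set functions with diminishing increments, localized to
a subset `S` of the ground set. -/
lemma le_sum_mul_inter_of_submodular {ι : Type*} [Fintype ι] [DecidableEq ι]
    {h : Finset ι → ℝ} (h_empty : h ∅ = 0) (h_mono : ∀ i A, h A ≤ h (insert i A))
    (h_sub : ∀ i A B, A ⊆ B → h (insert i B) + h A ≤ h (insert i A) + h B)
    {w : Finset ι → ℝ} (hw : ∀ A, 0 ≤ w A)
    (hcover : ∀ i, 1 ≤ ∑ A ∈ Finset.univ.filter (fun A => i ∈ A), w A) (S : Finset ι) :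
    h S ≤ ∑ A, w A * h (A ∩ S) := by
  induction S using Finset.induction_on with
  | empty => simp [h_empty]
  | insert i S _ ih =>
    calc
      h (insert i S) = h S + 1 * (h (insert i S) - h S) := by ring
      _ ≤ ∑ A, w A * h (A ∩ S) +
          (∑ A ∈ Finset.univ.filter (fun A => i ∈ A), w A) * (h (insert i S) - h S) :=
        add_le_add ih (mul_le_mul_of_nonneg_right (hcover i) (sub_nonneg.2 (h_mono i S)))
      _ = ∑ A, (w A * h (A ∩ S) + if i ∈ A then w A * (h (insert i S) - h S) else 0) := by
        rw [Finset.sum_add_distrib, Finset.sum_mul, Finset.sum_filter]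
      _ ≤ ∑ A, w A * h (A ∩ insert i S) := by
        refine Finset.sum_le_sum fun A _ => ?_
        split_ifs with hi
        · rw [Finset.inter_insert_of_mem hi, ← mul_add]
          refine mul_le_mul_of_nonneg_left ?_ (hw A)
          linarith [h_sub i (A ∩ S) S Finset.inter_subset_right]
        · rw [Finset.inter_insert_of_notMem hi, add_zero]

/-- Shearer's inequality for monotone set functions with diminishing increments. -/
lemma le_sum_mul_of_submodular {ι : Type*} [Fintype ι] [DecidableEq ι]
    {h : Finset ι → ℝ} (h_empty : h ∅ = 0) (h_mono : ∀ i A, h A ≤ h (insert i A))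
    (h_sub : ∀ i A B, A ⊆ B → h (insert i B) + h A ≤ h (insert i A) + h B)
    {w : Finset ι → ℝ} (hw : ∀ A, 0 ≤ w A)
    (hcover : ∀ i, 1 ≤ ∑ A ∈ Finset.univ.filter (fun A => i ∈ A), w A) :
    h Finset.univ ≤ ∑ A, w A * h A := by
  simpa using le_sum_mul_inter_of_submodular h_empty h_mono h_sub hw hcover Finset.univ

/-- Shearer's inequality. -/
theorem stmt6 {Ω : Type*} [Fintype Ω] (p : Ω → ℝ)
    (hp : ∀ ω, 0 ≤ p ω) (hp1 : ∑ ω, p ω = 1)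
    (k : ℕ) (α : Fin k → Type*) [∀ i, Fintype (α i)] [∀ i, DecidableEq (α i)]
    (X : ∀ i, Ω → α i)
    (w : Finset (Fin k) → ℝ) (hw : ∀ A, 0 ≤ w A)
    (hcover : ∀ i : Fin k, 1 ≤ ∑ A ∈ Finset.univ.filter (fun A => i ∈ A), w A) :
    shannonEntropy p (fun ω => fun i => X i ω) ≤
      ∑ A : Finset (Fin k),
        w A * shannonEntropy p (fun ω => fun i : {j // j ∈ A} => X i.1 ω) := by
  have key := le_sum_mul_of_submodular
    (h := fun A => shannonEntropy p (fun ω => fun i : {j // j ∈ A} => X i.1 ω))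
    (shannonEntropy_of_subsingleton hp1 _)
    (fun i A => shannonEntropy_le_of_imp hp fun ω ω' => by
      simp only [funext_iff, Subtype.forall, Finset.mem_insert]
      exact fun h j hj => h j (Or.inr hj))
    (fun i A B hAB => by
      have h := shannonEntropy_submodular hp hp1 (X i)
        (fun ω => fun i : {j // j ∈ B} => X i.1 ω) (fun ω => fun i : {j // j ∈ A} => X i.1 ω)
      convert h using 2 <;> refine shannonEntropy_congr hp fun ω ω' => ?_ <;>
        simp only [Prod.mk.injEq, funext_iff, Subtype.forall, Finset.mem_insert,
          forall_eq_or_imp]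
      · exact and_congr_right fun _ => ⟨fun h => ⟨h, fun j hj => h j (hAB hj)⟩, And.left⟩
      · exact ⟨fun h => ⟨h, fun j hj => h j (hAB hj)⟩, And.left⟩)
    hw hcover
  refine (shannonEntropy_congr hp fun ω ω' => ?_).trans_le key
  simp [funext_iff]
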